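/- arXiv:2402.09673 — 9 statements merged into one kernel-verified Lean document; each statement's English description precedes it below -/
import Mathlib

section
/- For all integers a ≥ 0 and b ≥ 1, Σ_{i=b}^{a} η'(a,i) = 2^{a−b} · η'(a−1, b−1). -/
/-- The Gaussian binomial coefficient `binom₂(a,b)` (base 2), as a rational number;
`0` when `b < 0` or `b > a`. -/
def gbinom (a b : ℤ) : ℚ :=
  if 0 ≤ b ∧ b ≤ a then
    ∏ ι ∈ Finset.range b.toNat, (((2 : ℚ) ^ (a - (ι : ℤ)) - 1) / ((2 : ℚ) ^ (b - (ι : ℤ)) - 1))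
  else 0

/-- `η'(a,b) = binom₂(a,b) · (−1)^{a−b} · 2^{(a−b)(a−b−1)/2}`. -/
def etaP (a b : ℤ) : ℚ :=
  gbinom a b * (-1 : ℚ) ^ (a - b) * (2 : ℚ) ^ ((a - b) * (a - b - 1) / 2)

/-- Absorption: `(2^b - 1) binom₂(a,b) = (2^a - 1) binom₂(a-1,b-1)`. -/
theorem two_zpow_sub_one_mul_gbinom (a b : ℤ) (hb : 1 ≤ b) :
    ((2 : ℚ) ^ b - 1) * gbinom a b = ((2 : ℚ) ^ a - 1) * gbinom (a - 1) (b - 1) := by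
  obtain ⟨n, rfl⟩ : ∃ n : ℕ, b = n + 1 := ⟨(b - 1).toNat, by omega⟩
  have hne : (2 : ℚ) ^ ((n : ℤ) + 1) - 1 ≠ 0 :=
    (sub_pos.mpr (one_lt_zpow₀ (by norm_num) (by omega))).ne'
  unfold gbinom
  by_cases h : (n : ℤ) + 1 ≤ a
  · rw [if_pos ⟨by omega, h⟩, if_pos ⟨by omega, by omega⟩,
      show ((n : ℤ) + 1).toNat = n + 1 by omega, show ((n : ℤ) + 1 - 1).toNat = n by omega,
      Finset.prod_range_succ']
    have hprod : ∀ ι ∈ Finset.range n,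
        ((2 : ℚ) ^ (a - ((ι + 1 : ℕ) : ℤ)) - 1) / ((2 : ℚ) ^ ((n : ℤ) + 1 - ((ι + 1 : ℕ) : ℤ)) - 1) =
        ((2 : ℚ) ^ (a - 1 - (ι : ℤ)) - 1) / ((2 : ℚ) ^ ((n : ℤ) + 1 - 1 - (ι : ℤ)) - 1) := by
      intro ι _
      rw [show a - ((ι + 1 : ℕ) : ℤ) = a - 1 - ι by push_cast; ring,
        show (n : ℤ) + 1 - ((ι + 1 : ℕ) : ℤ) = n + 1 - 1 - ι by push_cast; ring]
    rw [Finset.prod_congr rfl hprod]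
    simp only [Nat.cast_zero, sub_zero]
    field_simp
  · rw [if_neg (by omega), if_neg (by omega)]
    simp

/-- Raising the lower index: `(2^b - 1) binom₂(a,b) = (2^(a-b+1) - 1) binom₂(a,b-1)`. -/
theorem two_zpow_sub_one_mul_gbinom_eq_lower (a b : ℤ) (hb : 1 ≤ b) :
    ((2 : ℚ) ^ b - 1) * gbinom a b = ((2 : ℚ) ^ (a - b + 1) - 1) * gbinom a (b - 1) := by
  obtain ⟨n, rfl⟩ : ∃ n : ℕ, b = n + 1 := ⟨(b - 1).toNat, by omega⟩
  have hne : (2 : ℚ) ^ ((n : ℤ) + 1) - 1 ≠ 0 :=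
    (sub_pos.mpr (one_lt_zpow₀ (by norm_num) (by omega))).ne'
  unfold gbinom
  by_cases h : (n : ℤ) + 1 ≤ a
  · rw [if_pos ⟨by omega, h⟩, if_pos ⟨by omega, by omega⟩,
      show ((n : ℤ) + 1).toNat = n + 1 by omega, show ((n : ℤ) + 1 - 1).toNat = n by omega,
      Finset.prod_div_distrib, Finset.prod_div_distrib, Finset.prod_range_succ,
      Finset.prod_range_succ' (fun ι : ℕ => (2 : ℚ) ^ ((n : ℤ) + 1 - (ι : ℤ)) - 1)]
    have hprod : ∀ ι ∈ Finset.range n,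
        (2 : ℚ) ^ ((n : ℤ) + 1 - ((ι + 1 : ℕ) : ℤ)) - 1 =
        (2 : ℚ) ^ ((n : ℤ) + 1 - 1 - (ι : ℤ)) - 1 := by
      intro ι _
      rw [show (n : ℤ) + 1 - ((ι + 1 : ℕ) : ℤ) = n + 1 - 1 - ι by push_cast; ring]
    rw [Finset.prod_congr rfl hprod, show a - ((n : ℤ) + 1) + 1 = a - n by ring]
    simp only [Nat.cast_zero, sub_zero]
    field_simp
  · rw [if_neg (by omega)]
    by_cases h' : (n : ℤ) = a
    · simp [h']
    · rw [if_neg (by omega)]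
      simp

/-- The Pascal rule `binom₂(a,b) = 2^(a-b) binom₂(a-1,b-1) + binom₂(a-1,b)`. -/
theorem gbinom_pascal (a b : ℤ) (hb : 1 ≤ b) :
    gbinom a b = (2 : ℚ) ^ (a - b) * gbinom (a - 1) (b - 1) + gbinom (a - 1) b := by
  have hne : (2 : ℚ) ^ b - 1 ≠ 0 :=
    (sub_pos.mpr (one_lt_zpow₀ (by norm_num) (by omega))).ne'
  apply mul_left_cancel₀ hne
  have h₁ := two_zpow_sub_one_mul_gbinom a b hb
  have h₂ := two_zpow_sub_one_mul_gbinom_eq_lower (a - 1) b hb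
  rw [show a - 1 - b + 1 = a - b by ring] at h₂
  have h₃ : (2 : ℚ) ^ a = 2 ^ b * 2 ^ (a - b) := by
    rw [← zpow_add₀ (by norm_num)]
    congr 1
    ring
  rw [h₃] at h₁
  linear_combination h₁ - h₂

/-- The right-hand side of `etaP_partial_sum` telescopes. -/
theorem etaP_add_two_zpow_mul_etaP (a b : ℤ) (hb : 1 ≤ b) :
    etaP a b + (2 : ℚ) ^ (a - (b + 1)) * etaP (a - 1) b =
      (2 : ℚ) ^ (a - b) * etaP (a - 1) (b - 1) := by
  unfold etaP
  obtain ⟨m, rfl⟩ : ∃ m, a = m + b := ⟨a - b, by ring⟩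
  have hexp : (2 : ℚ) ^ (m * (m - 1) / 2) = 2 ^ (m - 1) * 2 ^ ((m - 1) * (m - 1 - 1) / 2) := by
    rw [← zpow_add₀ (by norm_num)]
    congr 1
    rw [show m * (m - 1) = (m - 1) * (m - 1 - 1) + (m - 1) * 2 by ring,
      Int.add_mul_ediv_right _ _ (by norm_num)]
    ring
  have hsign : (-1 : ℚ) ^ m = -(-1) ^ (m - 1) := by
    rw [zpow_sub_one₀ (by norm_num)]
    norm_num
  rw [gbinom_pascal (m + b) b hb, show m + b - (b + 1) = m - 1 by ring,
    show m + b - 1 - b = m - 1 by ring, show m + b - 1 - (b - 1) = m by ring,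
    show m + b - b = m by ring, hexp, hsign]
  ring

/-- Lemma 2, equation (21): partial sums of `η'`. -/
theorem etaP_partial_sum (a b : ℤ) (ha : 0 ≤ a) (hb : 1 ≤ b) :
    ∑ i ∈ Finset.Icc b a, etaP a i = (2 : ℚ) ^ (a - b) * etaP (a - 1) (b - 1) := by
  obtain hba | hba := lt_or_ge a b
  · rw [Finset.Icc_eq_empty (by omega), Finset.sum_empty, etaP, gbinom, if_neg (by omega)]
    simp
  obtain ⟨m, hm⟩ : ∃ m : ℕ, a - b = m := ⟨(a - b).toNat, by omega⟩
  induction m generalizing b with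
  | zero =>
    obtain rfl : a = b := by omega
    have h := etaP_add_two_zpow_mul_etaP a a hb
    have h₀ : etaP (a - 1) a = 0 := by
      rw [etaP, gbinom, if_neg (by omega)]
      simp
    rw [h₀, mul_zero, add_zero] at h
    rw [Finset.Icc_self, Finset.sum_singleton, h]
  | succ m ih =>
    have hIcc : Finset.Icc b a = insert b (Finset.Icc (b + 1) a) := by
      ext i
      simp only [Finset.mem_insert, Finset.mem_Icc]
      omega
    rw [hIcc, Finset.sum_insert (by simp), ih (b + 1) (by omega) (by omega) (by omega),
      add_sub_cancel_right, etaP_add_two_zpow_mul_etaP a b hb]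
end

section
/- For all integers a, b with 0 ≤ b ≤ a, Σ_{i=b}^{a} binom₂(a,i) · η'(i,b) equals 1 if a = b and equals 0 if a > b. -/
/-- The product `∏_{k=1}^{n} (2^k − 1)`, the base-2 factorial up to normalisation. -/
def qFactorialTwo (n : ℕ) : ℚ := ∏ k ∈ Finset.range n, ((2 : ℚ) ^ (k + 1) - 1)

theorem two_pow_succ_sub_one_ne_zero (n : ℕ) : (2 : ℚ) ^ (n + 1) - 1 ≠ 0 :=
  sub_ne_zero.2 (one_lt_pow₀ (by norm_num) (Nat.succ_ne_zero n)).ne'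

theorem qFactorialTwo_zero : qFactorialTwo 0 = 1 :=
  Finset.prod_range_zero _

theorem qFactorialTwo_succ (n : ℕ) :
    qFactorialTwo (n + 1) = qFactorialTwo n * ((2 : ℚ) ^ (n + 1) - 1) :=
  Finset.prod_range_succ _ n

theorem qFactorialTwo_ne_zero (n : ℕ) : qFactorialTwo n ≠ 0 :=
  Finset.prod_ne_zero_iff.2 fun k _ => two_pow_succ_sub_one_ne_zero k

theorem prod_two_zpow_ratio (n k : ℕ) :
    ∏ ι ∈ Finset.range k, (((2 : ℚ) ^ (((n + k : ℕ) : ℤ) - (ι : ℤ)) - 1) /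
      ((2 : ℚ) ^ ((k : ℤ) - (ι : ℤ)) - 1)) =
      qFactorialTwo (n + k) / (qFactorialTwo n * qFactorialTwo k) := by
  induction k with
  | zero => simp [qFactorialTwo_zero, div_self (qFactorialTwo_ne_zero n)]
  | succ k ih =>
    have hshift (m ι : ℕ) :
        ((m + 1 : ℕ) : ℤ) - ((ι + 1 : ℕ) : ℤ) = (m : ℤ) - (ι : ℤ) := by
      push_cast; ring
    rw [Finset.prod_range_succ', ← add_assoc]
    simp only [hshift]
    rw [ih, Nat.cast_zero, sub_zero, sub_zero, zpow_natCast, zpow_natCast,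
      qFactorialTwo_succ, qFactorialTwo_succ, div_mul_div_comm, mul_assoc]

theorem gbinom_natCast_add (n k : ℕ) :
    gbinom ((n + k : ℕ) : ℤ) (k : ℤ) =
      qFactorialTwo (n + k) / (qFactorialTwo n * qFactorialTwo k) := by
  rw [gbinom, if_pos (by omega), Int.toNat_natCast, prod_two_zpow_ratio]

theorem Int.mul_sub_one_ediv_two (j : ℕ) :
    ((j : ℤ) * ((j : ℤ) - 1)) / 2 = (j.choose 2 : ℕ) := by
  have h : (j : ℤ) * ((j : ℤ) - 1) = 2 * (j.choose 2 : ℕ) := by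
    induction j with
    | zero => simp
    | succ j ih =>
      rw [Nat.choose_succ_succ' j 1, Nat.choose_one_right]
      push_cast at ih ⊢
      linarith
  rw [h, Int.mul_ediv_cancel_left _ two_ne_zero]

theorem etaP_natCast_add (j b : ℕ) :
    etaP ((j + b : ℕ) : ℤ) (b : ℤ) =
      qFactorialTwo (j + b) / (qFactorialTwo j * qFactorialTwo b) * (-1) ^ j *
        2 ^ (j.choose 2) := by
  have h : ((j + b : ℕ) : ℤ) - (b : ℤ) = (j : ℤ) := by push_cast; ring
  rw [etaP, h, Int.mul_sub_one_ediv_two, gbinom_natCast_add, zpow_natCast, zpow_natCast]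

/-- Partial alternating sums of Gaussian binomials have a closed form. -/
theorem sum_range_alternating_qFactorialTwo (m k : ℕ) :
    ∑ j ∈ Finset.range (m + 1), (-1 : ℚ) ^ j * 2 ^ (j.choose 2) /
      (qFactorialTwo j * qFactorialTwo (m + k + 1 - j)) =
    (-1) ^ m * 2 ^ ((m + 1).choose 2) /
      (qFactorialTwo m * qFactorialTwo k * (2 ^ (m + k + 1) - 1)) := by
  induction m generalizing k with
  | zero => simp [qFactorialTwo_succ, qFactorialTwo_zero, mul_comm]
  | succ m ih =>
    rw [Finset.sum_range_succ, show m + 1 + k + 1 = m + (k + 1) + 1 by ring, ih (k + 1),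
      show m + (k + 1) + 1 - (m + 1) = k + 1 by omega, qFactorialTwo_succ, qFactorialTwo_succ,
      Nat.choose_succ_succ' (m + 1) 1, Nat.choose_one_right]
    have hm := two_pow_succ_sub_one_ne_zero m
    have hk := two_pow_succ_sub_one_ne_zero k
    have hmk := two_pow_succ_sub_one_ne_zero (m + (k + 1))
    have hFm := qFactorialTwo_ne_zero m
    have hFk := qFactorialTwo_ne_zero k
    field_simp
    ring

theorem sum_range_alternating_qFactorialTwo_eq_ite (n : ℕ) :
    ∑ j ∈ Finset.range (n + 1), (-1 : ℚ) ^ j * 2 ^ (j.choose 2) /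
      (qFactorialTwo j * qFactorialTwo (n - j)) = if n = 0 then 1 else 0 := by
  cases n with
  | zero => simp [qFactorialTwo_zero]
  | succ m =>
    have h := sum_range_alternating_qFactorialTwo m 0
    rw [add_zero] at h
    rw [Finset.sum_range_succ, h, if_neg (Nat.succ_ne_zero m), Nat.sub_self,
      qFactorialTwo_zero, qFactorialTwo_succ]
    have hm := two_pow_succ_sub_one_ne_zero m
    have hFm := qFactorialTwo_ne_zero m
    field_simp
    ring

theorem Finset.sum_Icc_natCast_add {M : Type*} [AddCommMonoid M] (f : ℤ → M) (n b : ℕ) :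
    ∑ i ∈ Finset.Icc (b : ℤ) ((n + b : ℕ) : ℤ), f i =
      ∑ j ∈ Finset.range (n + 1), f ((j + b : ℕ) : ℤ) := by
  symm
  refine Finset.sum_bij (fun j _ => ((j + b : ℕ) : ℤ)) ?_ ?_ ?_ fun _ _ => rfl
  · intro j hj
    simp only [Finset.mem_range, Finset.mem_Icc] at hj ⊢
    omega
  · intro i _ j _ h
    omega
  · intro i hi
    rw [Finset.mem_Icc] at hi
    exact ⟨(i - b).toNat, by rw [Finset.mem_range]; omega, by omega⟩

/-- Lemma 2, equation (22): the weighted sum `Σ_{i=b}^{a} binom₂(a,i) η'(i,b)`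
is `1` if `a = b` and `0` if `a > b`. -/
theorem etaP_weighted_sum (a b : ℤ) (hb : 0 ≤ b) (hba : b ≤ a) :
    ∑ i ∈ Finset.Icc b a, gbinom a i * etaP i b = if a = b then 1 else 0 := by
  lift b to ℕ using hb
  obtain ⟨n, rfl⟩ : ∃ n : ℕ, a = ((n + b : ℕ) : ℤ) := ⟨(a - b).toNat, by omega⟩
  have hterm : ∀ j ∈ Finset.range (n + 1),
      gbinom ((n + b : ℕ) : ℤ) ((j + b : ℕ) : ℤ) * etaP ((j + b : ℕ) : ℤ) (b : ℤ) =
        qFactorialTwo (n + b) / qFactorialTwo b * ((-1 : ℚ) ^ j * 2 ^ (j.choose 2) /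
          (qFactorialTwo j * qFactorialTwo (n - j))) := by
    intro j hj
    rw [Finset.mem_range] at hj
    rw [show n + b = (n - j) + (j + b) by omega, gbinom_natCast_add, etaP_natCast_add]
    have := qFactorialTwo_ne_zero (j + b)
    field_simp
  rw [Finset.sum_Icc_natCast_add, Finset.sum_congr rfl hterm, ← Finset.mul_sum,
    sum_range_alternating_qFactorialTwo_eq_ite]
  rcases Nat.eq_zero_or_pos n with rfl | hn
  · simp [div_self (qFactorialTwo_ne_zero b)]
  · rw [if_neg hn.ne', if_neg (by omega), mul_zero]
end

section
/- For every integer a ≥ 1, Σ_{j=1}^{a} j · η'(a,j) = ∏_{i=1}^{a−1} (1 − 2^i) (the empty product when a = 1, so both sides equal 1 in that case). -/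
theorem gbinom_natCast (n k : ℕ) :
    gbinom n k =
      (∏ i ∈ Finset.range k, ((2 : ℚ) ^ ((n : ℤ) - i) - 1)) /
        ∏ i ∈ Finset.range k, ((2 : ℚ) ^ (i + 1) - 1) := by
  have hden : ∏ i ∈ Finset.range k, ((2 : ℚ) ^ (i + 1) - 1) =
      ∏ i ∈ Finset.range k, ((2 : ℚ) ^ ((k : ℤ) - i) - 1) := by
    rw [← Finset.prod_range_reflect]
    refine Finset.prod_congr rfl fun i hi => ?_
    have hik : i < k := Finset.mem_range.mp hi
    rw [← zpow_natCast]
    congr 2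
    omega
  rw [hden, ← Finset.prod_div_distrib]
  unfold gbinom
  split_ifs with h
  · simp
  · refine (Finset.prod_eq_zero (i := n) (Finset.mem_range.mpr (by omega)) ?_).symm
    simp

theorem gbinom_zero_right (n : ℕ) : gbinom n 0 = 1 := by
  simpa using gbinom_natCast n 0

theorem gbinom_succ_self (n : ℕ) : gbinom n (n + 1) = 0 := by
  simp [gbinom]

theorem gbinom_succ_succ (n k : ℕ) :
    gbinom (n + 1) (k + 1) = gbinom n k + 2 ^ (k + 1) * gbinom n (k + 1) := by
  have h1 := gbinom_natCast (n + 1) (k + 1)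
  have h2 := gbinom_natCast n (k + 1)
  push_cast at h1 h2
  rw [h1, h2, gbinom_natCast, Finset.prod_range_succ', Finset.prod_range_succ _ k,
    Finset.prod_range_succ (fun i : ℕ => (2 : ℚ) ^ ((n : ℤ) - i) - 1) k]
  have hshift : ∀ i : ℕ, (n : ℤ) + 1 - ((i + 1 : ℕ) : ℤ) = n - i := by
    intro i
    push_cast
    ring
  simp only [hshift]
  have hpos : ∀ i : ℕ, (2 : ℚ) ^ (i + 1) - 1 ≠ 0 := fun i =>
    (sub_pos.mpr (one_lt_pow₀ (by norm_num) (Nat.succ_ne_zero i))).ne'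
  have hD : ∏ i ∈ Finset.range k, ((2 : ℚ) ^ (i + 1) - 1) ≠ 0 :=
    Finset.prod_ne_zero_iff.mpr fun i _ => hpos i
  have hk := hpos k
  have hpow : (2 : ℚ) ^ ((n : ℤ) + 1 - ((0 : ℕ) : ℤ)) = 2 ^ (k + 1) * 2 ^ ((n : ℤ) - k) := by
    rw [← zpow_natCast, ← zpow_add₀ two_ne_zero]
    congr 1
    push_cast
    ring
  rw [hpow]
  generalize (2 : ℚ) ^ ((n : ℤ) - k) = y
  generalize (2 : ℚ) ^ (k + 1) = x at *
  field_simp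
  ring

theorem two_zpow_triangle_succ (m : ℤ) :
    (2 : ℚ) ^ ((m + 1) * (m + 1 - 1) / 2) = 2 ^ (m * (m - 1) / 2) * 2 ^ m := by
  rw [← zpow_add₀ two_ne_zero, ← Int.add_mul_ediv_right _ _ two_ne_zero]
  congr 2
  ring

theorem etaP_succ_zero (n : ℕ) : etaP (n + 1) 0 = -2 ^ n * etaP n 0 := by
  have h := gbinom_zero_right (n + 1)
  push_cast at h
  rw [etaP, etaP, h, gbinom_zero_right, sub_zero, sub_zero, two_zpow_triangle_succ,
    zpow_add_one₀ (by norm_num), zpow_natCast 2 n]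
  ring

theorem etaP_succ_succ (n k : ℕ) :
    etaP (n + 1) (k + 1) = etaP n k - 2 ^ n * etaP n (k + 1) := by
  obtain ⟨m, hm⟩ : ∃ m : ℤ, m = n - (k + 1) := ⟨_, rfl⟩
  have hm' : (n : ℤ) - k = m + 1 := by omega
  have hpow : (2 : ℚ) ^ n = 2 ^ (k + 1) * 2 ^ m := by
    rw [← zpow_natCast, ← zpow_natCast, ← zpow_add₀ two_ne_zero]
    congr 1
    push_cast
    omega
  rw [etaP, etaP, etaP, add_sub_add_right_eq_sub, hm', ← hm, gbinom_succ_succ,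
    two_zpow_triangle_succ, zpow_add_one₀ (by norm_num), hpow]
  ring

theorem sum_mul_etaP_succ (f : ℕ → ℚ) (n : ℕ) :
    ∑ j ∈ Finset.range (n + 2), f j * etaP (n + 1) j =
      ∑ j ∈ Finset.range (n + 1), (f (j + 1) - 2 ^ n * f j) * etaP n j := by
  have htop : etaP n ((n + 1 : ℕ) : ℤ) = 0 := by
    push_cast
    rw [etaP, gbinom_succ_self]
    ring
  have hsplit : ∑ j ∈ Finset.range (n + 1), f j * etaP n j =
      ∑ j ∈ Finset.range (n + 1), f (j + 1) * etaP n (j + 1) + f 0 * etaP n 0 := by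
    have h := Finset.sum_range_succ (fun j : ℕ => f j * etaP n j) (n + 1)
    rw [htop, mul_zero, add_zero] at h
    rw [← h, Finset.sum_range_succ']
    push_cast
    rfl
  rw [Finset.sum_range_succ']
  push_cast
  simp only [etaP_succ_succ, etaP_succ_zero, sub_mul, mul_sub, Finset.sum_sub_distrib,
    mul_assoc, ← Finset.mul_sum, mul_left_comm (f _) (2 ^ n)]
  rw [hsplit]
  ring

theorem sum_etaP_succ (n : ℕ) : ∑ j ∈ Finset.range (n + 2), etaP (n + 1) j = 0 := by
  induction n with
  | zero => simpa using sum_mul_etaP_succ (fun _ => 1) 0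
  | succ n ih =>
    have h := sum_mul_etaP_succ (fun _ => 1) (n + 1)
    push_cast at h ⊢
    simp only [one_mul] at h
    rw [h, ← Finset.mul_sum, ih, mul_zero]

theorem sum_natCast_mul_etaP_succ (n : ℕ) :
    ∑ j ∈ Finset.range (n + 2), (j : ℚ) * etaP (n + 1) j =
      ∏ i ∈ Finset.range n, (1 - (2 : ℚ) ^ (i + 1)) := by
  induction n with
  | zero =>
    rw [sum_mul_etaP_succ (fun j => (j : ℚ)) 0]
    simp [etaP, gbinom]
  | succ n ih =>
    have h := sum_mul_etaP_succ (fun j => (j : ℚ)) (n + 1)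
    push_cast at h ⊢
    rw [h, Finset.prod_range_succ, ← ih, Finset.sum_mul, ← sub_eq_zero, ← Finset.sum_sub_distrib]
    refine (Finset.sum_congr rfl fun j _ => ?_).trans (sum_etaP_succ n)
    ring

theorem Int.image_natCast_add_one_range (n : ℕ) :
    (Finset.range n).image (fun i : ℕ => (i : ℤ) + 1) = Finset.Icc 1 (n : ℤ) := by
  ext x
  simp only [Finset.mem_image, Finset.mem_range, Finset.mem_Icc]
  constructor
  · rintro ⟨i, hi, rfl⟩
    omega
  · rintro ⟨h1, h2⟩
    exact ⟨(x - 1).toNat, by omega, by omega⟩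

/-- Lemma 2, equation (23): `Σ_{j=1}^{a} j·η'(a,j) = ∏_{i=1}^{a−1} (1 − 2^i)`. -/
theorem etaP_K_constants (a : ℤ) (ha : 1 ≤ a) :
    ∑ j ∈ Finset.Icc 1 a, (j : ℚ) * etaP a j = ∏ i ∈ Finset.Icc 1 (a - 1), (1 - (2 : ℚ) ^ i) := by
  obtain ⟨n, rfl⟩ : ∃ n : ℕ, a = n + 1 := ⟨(a - 1).toNat, by omega⟩
  have hinj : Function.Injective fun i : ℕ => (i : ℤ) + 1 := fun i j h => by
    simpa using h
  have h := sum_natCast_mul_etaP_succ n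
  rw [Finset.sum_range_succ'] at h
  have hIcc := Int.image_natCast_add_one_range (n + 1)
  push_cast at h hIcc
  rw [zero_mul, add_zero] at h
  rw [add_sub_cancel_right, ← hIcc, ← Int.image_natCast_add_one_range,
    Finset.sum_image hinj.injOn, Finset.prod_image hinj.injOn]
  push_cast
  rw [h]
  refine Finset.prod_congr rfl fun i _ => ?_
  norm_cast
end

section
/- For all integers b ≥ 1 and n ≥ 1, the sum Σ_{i=0}^{n} ( 2^{b·i} · ∏_{j=i}^{n} (1 − 2^j) ) is strictly negative. -/
/-- The sum `Σ_{i=0}^{n} x^i · ∏_{j=i}^{n} (1 - q^j)`. -/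
def qProdSum (q x : ℤ) (n : ℕ) : ℤ :=
  ∑ i ∈ Finset.range (n + 1), x ^ i * ∏ j ∈ Finset.Icc i n, (1 - q ^ j)

theorem qProdSum_zero (q x : ℤ) : qProdSum q x 0 = 0 := by
  simp [qProdSum]

theorem qProdSum_succ (q x : ℤ) (n : ℕ) :
    qProdSum q x (n + 1) = (1 - q ^ (n + 1)) * (qProdSum q x n + x ^ (n + 1)) := by
  have h : ∀ i ∈ Finset.range (n + 1), x ^ i * ∏ j ∈ Finset.Icc i (n + 1), (1 - q ^ j) =
      (1 - q ^ (n + 1)) * (x ^ i * ∏ j ∈ Finset.Icc i n, (1 - q ^ j)) := by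
    intro i hi
    rw [Finset.prod_Icc_succ_top (Finset.mem_range.mp hi).le]
    ring
  rw [qProdSum, Finset.sum_range_succ, Finset.sum_congr rfl h, ← Finset.mul_sum, ← qProdSum,
    Finset.Icc_self, Finset.prod_singleton]
  ring

/-- Scaling the variable by `q` lowers the length of the sum by one. -/
theorem qProdSum_mul_succ (q x : ℤ) (n : ℕ) :
    qProdSum q (q * x) (n + 1) =
      q * (1 - q ^ (n + 1)) * (x ^ (n + 1) - (x - 1) * qProdSum q x n) := by
  induction n with
  | zero => simp only [qProdSum_succ, qProdSum_zero]; ring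
  | succ n ih => rw [qProdSum_succ, ih, qProdSum_succ q x n]; ring

theorem qProdSum_two_pow_neg (b n : ℕ) : qProdSum 2 (2 ^ (b + 1)) (n + 1) < 0 := by
  induction b generalizing n with
  | zero =>
    have h := qProdSum_mul_succ 2 1 n
    have h2 : (1 : ℤ) < 2 ^ (n + 1) := one_lt_pow₀ (by norm_num) (by omega)
    norm_num at h ⊢
    linarith
  | succ b ih =>
    have h0 : qProdSum 2 (2 ^ (b + 1)) n ≤ 0 := by
      cases n with
      | zero => exact (qProdSum_zero _ _).le
      | succ n => exact (ih n).le
    have h2 : (1 : ℤ) < 2 ^ (n + 1) := one_lt_pow₀ (by norm_num) (by omega)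
    have hx : (1 : ℤ) < 2 ^ (b + 1) := one_lt_pow₀ (by norm_num) (by omega)
    have hp : (0 : ℤ) < (2 ^ (b + 1)) ^ (n + 1) := by positivity
    have hm := mul_nonpos_of_nonneg_of_nonpos (sub_nonneg.mpr hx.le) h0
    rw [pow_succ' 2 (b + 1), qProdSum_mul_succ]
    exact mul_neg_of_neg_of_pos (by linarith) (by linarith)

/-- Lemma 3: for integers `b ≥ 1` and `n ≥ 1`,
`Σ_{i=0}^{n} 2^{b·i} · ∏_{j=i}^{n} (1 − 2^j) < 0`. -/
theorem exponential_mersenne (b n : ℕ) (hb : 1 ≤ b) (hn : 1 ≤ n) :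
    ∑ i ∈ Finset.range (n + 1),
        (2 : ℤ) ^ (b * i) * ∏ j ∈ Finset.Icc i n, (1 - (2 : ℤ) ^ j) < 0 := by
  obtain ⟨b, rfl⟩ := Nat.exists_eq_add_of_le' hb
  obtain ⟨n, rfl⟩ := Nat.exists_eq_add_of_le' hn
  simpa only [qProdSum, pow_mul] using qProdSum_two_pow_neg b n
end

section
/- For every real β ≥ 1 and every integer n ≥ 1, the sum Σ_{i=0}^{n} ( 2^i · β^{2^i} · ∏_{j=i}^{n} (1 − 2^j) ) is strictly negative. -/
/-- The integers obtained by expanding the alternating sum in powers of `log β`; they are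
symmetric in their two indices. -/
noncomputable def logCoeff (k : ℕ) : ℕ → ℝ
  | 0 => 1
  | n + 1 => 2 ^ ((n + 1) * (k + 1)) - (2 ^ (n + 1) - 1) * logCoeff k n

lemma logCoeff_succ_left (k n : ℕ) :
    logCoeff (k + 1) n = 2 ^ ((n + 1) * (k + 1)) - (2 ^ (k + 1) - 1) * logCoeff k n := by
  induction n with
  | zero => simp [logCoeff]
  | succ n ih =>
    rw [logCoeff, ih, logCoeff]
    ring

lemma logCoeff_zero_left (n : ℕ) : logCoeff 0 n = 1 := by
  induction n with
  | zero => rfl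
  | succ n ih => simp [logCoeff, ih]

lemma logCoeff_comm (k n : ℕ) : logCoeff k n = logCoeff n k := by
  induction n with
  | zero => rw [logCoeff_zero_left, logCoeff]
  | succ n ih => rw [logCoeff_succ_left, logCoeff, ih, mul_comm (n + 1)]

lemma logCoeff_pos_and_le {k n : ℕ} (h : n ≤ k) :
    0 < logCoeff k n ∧ logCoeff k n ≤ 2 ^ (n * (k + 1)) := by
  induction n with
  | zero => simp [logCoeff]
  | succ n ih =>
    obtain ⟨hpos, hle⟩ := ih (by omega)
    have hone : (1 : ℝ) ≤ 2 ^ (n + 1) := one_le_pow₀ (by norm_num)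
    have hpow : (2 : ℝ) ^ (n + 1) ≤ 2 ^ (k + 1) :=
      pow_le_pow_right₀ (by norm_num) (by omega)
    have hsplit : (2 : ℝ) ^ ((n + 1) * (k + 1)) = 2 ^ (k + 1) * 2 ^ (n * (k + 1)) := by ring
    have hmul : (2 ^ (n + 1) - 1) * logCoeff k n ≤ (2 ^ (k + 1) - 1) * 2 ^ (n * (k + 1)) := by
      gcongr
      linarith
    have hpos' : (0 : ℝ) < 2 ^ (n * (k + 1)) := by positivity
    rw [logCoeff]
    constructor
    · rw [hsplit]
      linarith
    · linarith [mul_nonneg (sub_nonneg.2 hone) hpos.le]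

lemma logCoeff_pos (k n : ℕ) : 0 < logCoeff k n := by
  rcases le_total n k with h | h
  · exact (logCoeff_pos_and_le h).1
  · rw [logCoeff_comm]
    exact (logCoeff_pos_and_le h).1

/-- The alternating sum up to index `n + 1`, divided by `1 - 2 ^ (n + 1)`. -/
noncomputable def reducedSum (β : ℝ) : ℕ → ℝ
  | 0 => 2 * β ^ 2
  | n + 1 => 2 ^ (n + 2) * β ^ (2 ^ (n + 2)) - (2 ^ (n + 1) - 1) * reducedSum β n

lemma hasSum_mul_exp_mul (c t : ℝ) :
    HasSum (fun k : ℕ => t ^ k / (k.factorial : ℝ) * c ^ (k + 1)) (c * Real.exp (c * t)) := by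
  have h := (NormedSpace.expSeries_div_hasSum_exp (c * t)).mul_left c
  rw [← Real.exp_eq_exp_ℝ] at h
  refine h.congr_fun fun k => ?_
  ring

lemma hasSum_reducedSum (t : ℝ) (n : ℕ) :
    HasSum (fun k : ℕ => t ^ k / (k.factorial : ℝ) * (2 ^ (k + 1) * logCoeff k n))
      (reducedSum (Real.exp t) n) := by
  induction n with
  | zero =>
    have h := hasSum_mul_exp_mul 2 t
    simpa [logCoeff, reducedSum, ← Real.exp_nat_mul] using h
  | succ n ih =>
    have h := (hasSum_mul_exp_mul (2 ^ (n + 2)) t).sub (ih.mul_left (2 ^ (n + 1) - 1))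
    rw [reducedSum, ← Real.exp_nat_mul]
    push_cast
    refine h.congr_fun fun k => ?_
    have hpow : ((2 : ℝ) ^ (n + 2)) ^ (k + 1) = 2 ^ (k + 1) * 2 ^ ((n + 1) * (k + 1)) := by
      rw [← pow_mul, ← pow_add]
      congr 1
      ring
    rw [logCoeff, hpow]
    ring

lemma reducedSum_pos {β : ℝ} (hβ : 1 ≤ β) (n : ℕ) : 0 < reducedSum β n := by
  have ht : 0 ≤ Real.log β := Real.log_nonneg hβ
  have h := hasSum_reducedSum (Real.log β) n
  rw [Real.exp_log (by linarith)] at h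
  have hcoeff (k : ℕ) : 0 < 2 ^ (k + 1) * logCoeff k n :=
    mul_pos (by positivity) (logCoeff_pos k n)
  refine lt_of_lt_of_le ?_ (le_hasSum h 0 fun k _ => mul_nonneg (by positivity) (hcoeff k).le)
  simpa using hcoeff 0

lemma sum_range_succ_mul_prod_Icc {R : Type*} [CommRing R] (a b : ℕ → R) (n : ℕ) :
    ∑ i ∈ Finset.range (n + 2), a i * ∏ j ∈ Finset.Icc i (n + 1), b j =
      (∑ i ∈ Finset.range (n + 1), a i * ∏ j ∈ Finset.Icc i n, b j + a (n + 1)) * b (n + 1) := by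
  rw [Finset.sum_range_succ, add_mul, Finset.sum_mul, Finset.Icc_self, Finset.prod_singleton]
  congr 1
  refine Finset.sum_congr rfl fun i hi => ?_
  rw [Finset.prod_Icc_succ_top (by have := Finset.mem_range.1 hi; omega), mul_assoc]

lemma sum_eq_mul_reducedSum (β : ℝ) (n : ℕ) :
    ∑ i ∈ Finset.range (n + 2),
        (2 : ℝ) ^ i * β ^ (2 ^ i) * ∏ j ∈ Finset.Icc i (n + 1), (1 - (2 : ℝ) ^ j) =
      (1 - 2 ^ (n + 1)) * reducedSum β n := by
  induction n with
  | zero =>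
    rw [sum_range_succ_mul_prod_Icc (fun i => (2 : ℝ) ^ i * β ^ (2 ^ i))]
    simp [reducedSum, mul_comm]
  | succ n ih =>
    rw [sum_range_succ_mul_prod_Icc (fun i => (2 : ℝ) ^ i * β ^ (2 ^ i)), ih, reducedSum]
    ring

/-- Lemma 4: for real `β ≥ 1` and integer `n ≥ 1`,
`Σ_{i=0}^{n} 2^i · β^{2^i} · ∏_{j=i}^{n} (1 − 2^j) < 0`. -/
theorem superexponential (β : ℝ) (hβ : 1 ≤ β) (n : ℕ) (hn : 1 ≤ n) :
    ∑ i ∈ Finset.range (n + 1),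
        (2 : ℝ) ^ i * β ^ (2 ^ i) * ∏ j ∈ Finset.Icc i n, (1 - (2 : ℝ) ^ j) < 0 := by
  obtain ⟨m, rfl⟩ := Nat.exists_eq_add_of_le' hn
  rw [sum_eq_mul_reducedSum]
  have h : (1 : ℝ) < 2 ^ (m + 1) := one_lt_pow₀ (by norm_num) (by omega)
  exact mul_neg_of_neg_of_pos (by linarith) (reducedSum_pos hβ m)
end

section
/- Fixed-erasure-count equivocation formula (Theorem 1, μ version): for every integer μ with 1 ≤ μ ≤ n, Σ_{r ⊆ Fin n, |r| = μ} rank(G_r) = C(n,μ)·κ − Σ_{δ=1}^{κ} K_δ · Σ_{S : dim S = κ−δ} C(m_S, μ), where C(·,·) is the ordinary binomial coefficient, the inner sum is over all subspaces S of (ZMod 2)^κ of dimension κ−δ, and the identity holds in the integers. -/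
attribute [local instance] Classical.propDecidable

noncomputable instance {κ : ℕ} : Fintype (Submodule (ZMod 2) (Fin κ → ZMod 2)) :=
  haveI : Finite (Submodule (ZMod 2) (Fin κ → ZMod 2)) :=
    Finite.of_injective (fun S => (S : Set (Fin κ → ZMod 2))) SetLike.coe_injective
  Fintype.ofFinite _

/-- `rank(G_r)`: the dimension over `ZMod 2` of the span of the columns of `G`
indexed by the subset `r`. -/
noncomputable def colRank {κ n : ℕ} (G : Matrix (Fin κ) (Fin n) (ZMod 2))
    (r : Finset (Fin n)) : ℕ :=
  Module.finrank (ZMod 2)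
    (Submodule.span (ZMod 2) ((fun j => fun i => G i j) '' (r : Set (Fin n))))

/-- `m_S`: the number of column indices `j` whose column `G_·j` lies in `S`. -/
noncomputable def colCount {κ n : ℕ} (G : Matrix (Fin κ) (Fin n) (ZMod 2))
    (S : Submodule (ZMod 2) (Fin κ → ZMod 2)) : ℕ :=
  (Finset.univ.filter (fun j : Fin n => (fun i => G i j) ∈ S)).card

/-- The number of linear maps to `X` with kernel `S`. -/
theorem card_linearMap_ker_eq {K V X : Type*} [Field K] [Fintype K] [AddCommGroup V] [Module K V]
    [FiniteDimensional K V] [AddCommGroup X] [Module K X] [FiniteDimensional K X]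
    (S : Submodule K V) (h : Module.finrank K (V ⧸ S) ≤ Module.finrank K X) :
    (Nat.card {φ : V →ₗ[K] X // LinearMap.ker φ = S} : ℤ) =
      ∏ i ∈ Finset.range (Module.finrank K (V ⧸ S)),
        ((Fintype.card K : ℤ) ^ Module.finrank K X - (Fintype.card K : ℤ) ^ i) := by
  have : Finite X := Module.finite_of_finite K
  have b := Module.finBasis K (V ⧸ S)
  have hinj : Nat.card {φ : V →ₗ[K] X // LinearMap.ker φ = S} =
      Nat.card {s : Fin (Module.finrank K (V ⧸ S)) → X // LinearIndependent K s} := by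
    refine Nat.card_congr (Equiv.ofBijective
      (fun s : {s : Fin (Module.finrank K (V ⧸ S)) → X // LinearIndependent K s} =>
        (⟨(b.constr K s.1).comp S.mkQ, ?_⟩ : {φ : V →ₗ[K] X // LinearMap.ker φ = S}))
      ⟨?_, ?_⟩).symm
    · have hs : LinearMap.ker (b.constr K s.1) = ⊥ := by
        rw [LinearMap.ker_eq_bot]
        exact b.injective_constr_of_linearIndependent s.2
      rw [LinearMap.ker_comp, hs, Submodule.comap_bot, Submodule.ker_mkQ]
    · rintro ⟨s, hs⟩ ⟨t, ht⟩ hst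
      have := Submodule.linearMap_qext _ (Subtype.ext_iff.1 hst)
      exact Subtype.ext ((b.constr K).injective this)
    · rintro ⟨φ, rfl⟩
      refine ⟨⟨fun i => (LinearMap.ker φ).liftQ φ le_rfl (b i), ?_⟩, ?_⟩
      · exact b.linearIndependent.map' _ (by simp [Submodule.ker_liftQ_eq_bot'])
      · refine Subtype.ext ?_
        have : b.constr K (fun i => (LinearMap.ker φ).liftQ φ le_rfl (b i)) =
            (LinearMap.ker φ).liftQ φ le_rfl := b.ext fun i => by simp
        simp only [this, Submodule.liftQ_mkQ]
  have : Fintype X := Fintype.ofFinite X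
  rw [hinj, card_linearIndependent h, ← Fin.prod_univ_eq_prod_range
    (fun i => (Fintype.card K : ℤ) ^ Module.finrank K X - (Fintype.card K : ℤ) ^ i), Nat.cast_prod]
  refine Finset.prod_congr rfl fun i _ => ?_
  rw [Nat.cast_sub (Nat.pow_le_pow_right Fintype.card_pos (i.2.le.trans h))]
  push_cast
  rfl

theorem card_linearMap_le_ker {K V X : Type*} [Field K] [Fintype K] [AddCommGroup V] [Module K V]
    [FiniteDimensional K V] [AddCommGroup X] [Module K X] [FiniteDimensional K X]
    (U : Submodule K V) :
    Nat.card {φ : V →ₗ[K] X // U ≤ LinearMap.ker φ} =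
      (Fintype.card K ^ Module.finrank K X) ^ Module.finrank K (V ⧸ U) := by
  have e : ((V ⧸ U) →ₗ[K] X) ≃ {φ : V →ₗ[K] X // U ≤ LinearMap.ker φ} :=
    { toFun g := ⟨g.comp U.mkQ, by simpa using LinearMap.ker_le_ker_comp U.mkQ g⟩
      invFun φ := U.liftQ φ.1 φ.2
      left_inv g := Submodule.linearMap_qext _ (by simp)
      right_inv φ := Subtype.ext (by simp) }
  rw [← Nat.card_congr e, Module.natCard_eq_pow_finrank (K := K), Module.finrank_linearMap,
    Nat.card_eq_fintype_card, ← pow_mul, mul_comm]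

open Polynomial in
/-- The `q`-analogue of expanding a power in falling factorials, indexed by the subspaces
containing `U`. -/
theorem X_pow_finrank_quotient_eq_sum {K V : Type*} [Field K] [Fintype K] [AddCommGroup V]
    [Module K V] [FiniteDimensional K V] [Fintype (Submodule K V)] (U : Submodule K V) :
    (X : ℤ[X]) ^ Module.finrank K (V ⧸ U) =
      ∑ S : Submodule K V with U ≤ S, ∏ i ∈ Finset.range (Module.finrank K (V ⧸ S)),
        (X - C ((Fintype.card K : ℤ) ^ i)) := by
  classical
  refine Polynomial.eq_of_infinite_eval_eq _ _ (Set.infinite_of_injective_forall_mem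
    (f := fun N : ℕ => (Fintype.card K : ℤ) ^ (Module.finrank K V + N)) ?_ fun N => ?_)
  · intro a b hab
    have := Int.pow_right_injective (a := Fintype.card K)
      (by simpa using Fintype.one_lt_card (α := K)) hab
    omega
  · set Y := Fin (Module.finrank K V + N) → K
    have hY : Module.finrank K Y = Module.finrank K V + N := by simp [Y]
    have : Finite (V →ₗ[K] Y) := Module.finite_of_finite K
    have : Fintype (V →ₗ[K] Y) := Fintype.ofFinite _
    have hcard := card_linearMap_le_ker (X := Y) U
    rw [Nat.card_eq_fintype_card, Fintype.card_subtype,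
      Finset.card_eq_sum_card_fiberwise (f := LinearMap.ker)
        (t := Finset.univ.filter fun S : Submodule K V => U ≤ S)
        (by intro φ hφ; simpa using hφ)] at hcard
    simp only [Set.mem_ofPred_eq, eval_pow, eval_X, eval_finsetSum, eval_prod, eval_sub, eval_C]
    rw [← hY]
    have hcard' := congrArg (Nat.cast : ℕ → ℤ) hcard
    push_cast at hcard'
    rw [← hcard']
    refine Finset.sum_congr rfl fun S hS => ?_
    rw [← card_linearMap_ker_eq S
      (by rw [hY]; exact (Submodule.finrank_quotient_le S).trans (Nat.le_add_right _ _)),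
      Nat.card_eq_fintype_card, Fintype.card_subtype, Finset.filter_filter]
    congr 2
    ext φ
    have hUS : U ≤ S := by simpa using hS
    simp only [Finset.mem_filter, Finset.mem_univ, true_and, and_iff_right_iff_imp]
    rintro rfl
    exact hUS

open Polynomial in
theorem eval_one_derivative_prod_X_sub_pow (q : ℤ) (d : ℕ) :
    (derivative (∏ i ∈ Finset.range d, (X - C (q ^ i)))).eval 1 =
      if d = 0 then 0 else ∏ i ∈ Finset.Icc 1 (d - 1), (1 - q ^ i) := by
  cases d with
  | zero => simp
  | succ d =>
    rw [Finset.prod_range_succ', derivative_mul]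
    simp only [pow_zero, eval_add, eval_mul, eval_sub, eval_X, eval_C, sub_self, mul_zero,
      derivative_sub, derivative_X, derivative_C, sub_zero, mul_one, zero_add, eval_prod,
      Nat.add_sub_cancel, Nat.add_eq_zero_iff, one_ne_zero, and_false, if_false]
    rw [Finset.range_eq_Ico, Finset.prod_Ico_add' (fun i => 1 - q ^ i) 0 d 1]
    rfl

theorem finrank_quotient_eq_sum {K V : Type*} [Field K] [Fintype K] [AddCommGroup V]
    [Module K V] [FiniteDimensional K V] [Fintype (Submodule K V)] (U : Submodule K V) :
    (Module.finrank K (V ⧸ U) : ℤ) = ∑ S : Submodule K V with U ≤ S,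
      if Module.finrank K (V ⧸ S) = 0 then 0
      else ∏ i ∈ Finset.Icc 1 (Module.finrank K (V ⧸ S) - 1), (1 - (Fintype.card K : ℤ) ^ i) := by
  have h := congrArg (fun p => (Polynomial.derivative p).eval 1) (X_pow_finrank_quotient_eq_sum U)
  simp only [Polynomial.derivative_sum, Polynomial.eval_finsetSum,
    eval_one_derivative_prod_X_sub_pow] at h
  simpa [Polynomial.derivative_X_pow] using h

theorem choose_colCount {κ n : ℕ} (G : Matrix (Fin κ) (Fin n) (ZMod 2))
    (S : Submodule (ZMod 2) (Fin κ → ZMod 2)) (μ : ℕ) :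
    (colCount G S).choose μ = ((Finset.powersetCard μ (Finset.univ : Finset (Fin n))).filter
      fun r : Finset (Fin n) =>
        Submodule.span (ZMod 2) ((fun j i => G i j) '' (r : Set (Fin n))) ≤ S).card := by
  rw [colCount, ← Finset.card_powersetCard]
  congr 1
  ext r
  simp [Submodule.span_le, Set.subset_def, Finset.subset_iff, and_comm]

/-- Theorem 1 (fixed number of revealed bits `μ`):
`Σ_{|r|=μ} rank(G_r) = C(n,μ)·κ − Σ_{δ=1}^{κ} K_δ Σ_{dim S = κ−δ} C(m_S, μ)`. -/
theorem equivocation_mu (κ n : ℕ) (hκ : 1 ≤ κ) (hn : 1 ≤ n)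
    (G : Matrix (Fin κ) (Fin n) (ZMod 2)) (μ : ℕ) (hμ1 : 1 ≤ μ) (hμn : μ ≤ n) :
    ∑ r ∈ Finset.powersetCard μ (Finset.univ : Finset (Fin n)), (colRank G r : ℤ)
      = (n.choose μ : ℤ) * κ -
          ∑ δ ∈ Finset.Icc 1 κ,
            (∏ i ∈ Finset.Icc 1 (δ - 1), (1 - (2 : ℤ) ^ i)) *
              ∑ S ∈ Finset.univ.filter
                  (fun S : Submodule (ZMod 2) (Fin κ → ZMod 2) =>
                    Module.finrank (ZMod 2) S = κ - δ),
                ((colCount G S).choose μ : ℤ) := by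
  set w : Submodule (ZMod 2) (Fin κ → ZMod 2) → ℤ := fun S =>
    if Module.finrank (ZMod 2) (_ ⧸ S) = 0 then 0
    else ∏ i ∈ Finset.Icc 1 (Module.finrank (ZMod 2) (_ ⧸ S) - 1), (1 - (2 : ℤ) ^ i) with hw
  have hquot (S : Submodule (ZMod 2) (Fin κ → ZMod 2)) :
      Module.finrank (ZMod 2) (_ ⧸ S) + Module.finrank (ZMod 2) S = κ := by
    simpa using S.finrank_quotient_add_finrank
  have hrank (r : Finset (Fin n)) : (colRank G r : ℤ) = κ - ∑ S,
      if Submodule.span (ZMod 2) ((fun j i => G i j) '' (r : Set (Fin n))) ≤ S then w S else 0 := by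
    have h := finrank_quotient_eq_sum
      (Submodule.span (ZMod 2) ((fun j i => G i j) '' (r : Set (Fin n))))
    have hd := hquot (Submodule.span (ZMod 2) ((fun j i => G i j) '' (r : Set (Fin n))))
    rw [← Finset.sum_filter]
    simp only [ZMod.card, Nat.cast_ofNat] at h
    simp only [hw, colRank]
    rw [← h]
    omega
  have hsum : ∑ δ ∈ Finset.Icc 1 κ, (∏ i ∈ Finset.Icc 1 (δ - 1), (1 - (2 : ℤ) ^ i)) *
      ∑ S ∈ Finset.univ.filter (fun S : Submodule (ZMod 2) (Fin κ → ZMod 2) =>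
        Module.finrank (ZMod 2) S = κ - δ), ((colCount G S).choose μ : ℤ) =
      ∑ S, w S * ((colCount G S).choose μ : ℤ) := by
    simp only [Finset.mul_sum, Finset.sum_filter]
    rw [Finset.sum_comm]
    refine Finset.sum_congr rfl fun S _ => ?_
    have hS := hquot S
    simp only [hw]
    split_ifs with h0
    · rw [zero_mul]
      refine Finset.sum_eq_zero fun δ hδ => ?_
      rw [Finset.mem_Icc] at hδ
      rw [if_neg (by omega), mul_zero]
    · rw [Finset.sum_eq_single (Module.finrank (ZMod 2) (_ ⧸ S)), if_pos (by omega)]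
      · intro δ hδ hne
        rw [Finset.mem_Icc] at hδ
        rw [if_neg (by omega), mul_zero]
      · intro hmem
        rw [Finset.mem_Icc] at hmem
        omega
  rw [hsum, Finset.sum_congr rfl fun r _ => hrank r, Finset.sum_sub_distrib, Finset.sum_const,
    Finset.card_powersetCard, Finset.card_univ, Fintype.card_fin, nsmul_eq_mul, Finset.sum_comm]
  congr 1
  refine Finset.sum_congr rfl fun S _ => ?_
  rw [choose_colCount, ← Finset.sum_filter, Finset.sum_const, nsmul_eq_mul, mul_comm]
end

section
/- Fixed-erasure-probability equivocation formula (Theorem 1, ε version): for every real ε with 0 < ε < 1, Σ_{r ⊆ Fin n} ε^{n−|r|} (1−ε)^{|r|} · rank(G_r) = κ − Σ_{δ=1}^{κ} K_δ · Σ_{S : dim S = κ−δ} ε^{n − m_S}, where the outer sum is over all subsets r of Fin n and the inner sum is over all subspaces S of (ZMod 2)^κ of dimension κ−δ. -/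
attribute [local instance] Classical.propDecidable

section

open Polynomial

/-- Injective linear maps are the same as linearly independent images of a basis. -/
theorem natCard_injective_linearMap {K V U : Type*} [Field K] [Fintype K]
    [AddCommGroup V] [Module K V] [Module.Finite K V]
    [AddCommGroup U] [Module K U] [Finite U] :
    (Nat.card {f : V →ₗ[K] U // Function.Injective f} : ℝ) =
      ∏ i ∈ Finset.range (Module.finrank K V),
        ((Fintype.card K : ℝ) ^ Module.finrank K U - (Fintype.card K : ℝ) ^ i) := by
  have : Module.Finite K U := Module.Finite.of_finite
  let b := Module.finBasis K V
  have key (f : V →ₗ[K] U) : LinearIndependent K (⇑f ∘ ⇑b) ↔ Function.Injective f := by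
    have h : Finsupp.linearCombination K (⇑f ∘ ⇑b) = f ∘ₗ b.repr.symm.toLinearMap := by
      ext i
      simp
    rw [LinearIndependent, h, LinearMap.coe_comp]
    exact Function.Injective.of_comp_iff' f b.repr.symm.bijective
  have e : {f : V →ₗ[K] U // Function.Injective f} ≃
      {s : Fin (Module.finrank K V) → U // LinearIndependent K s} :=
    (b.constr K).symm.toEquiv.subtypeEquiv fun f => (key f).symm
  rw [Nat.card_congr e]
  by_cases hk : Module.finrank K V ≤ Module.finrank K U
  · rw [card_linearIndependent hk, Finset.prod_range]
    push_cast
    refine Finset.prod_congr rfl fun i _ => ?_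
    rw [Nat.cast_sub (Nat.pow_le_pow_right Fintype.card_pos (by omega))]
    push_cast
    rfl
  · rw [Finset.prod_eq_zero (Finset.mem_range.2 (not_le.1 hk)) (sub_self _)]
    have : IsEmpty {s : Fin (Module.finrank K V) → U // LinearIndependent K s} :=
      ⟨fun s => hk (by simpa using s.2.fintype_card_le_finrank)⟩
    simp

/-- Linear maps out of `V ⧸ T` are the linear maps out of `V` vanishing on `T`. -/
def Submodule.liftQEquiv {K V U : Type*} [Field K] [AddCommGroup V] [Module K V]
    [AddCommGroup U] [Module K U] (T : Submodule K V) :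
    {f : V →ₗ[K] U // T ≤ LinearMap.ker f} ≃ (V ⧸ T →ₗ[K] U) where
  toFun f := T.liftQ f.1 f.2
  invFun g := ⟨g ∘ₗ T.mkQ, fun x hx => by simp [(Submodule.Quotient.mk_eq_zero T).2 hx]⟩
  left_inv f := by ext; simp
  right_inv g := by ext; simp

theorem Submodule.natCard_ker_eq {K V U : Type*} [Field K] [Fintype K]
    [AddCommGroup V] [Module K V] [Module.Finite K V]
    [AddCommGroup U] [Module K U] [Finite U] (S : Submodule K V) :
    (Nat.card {f : V →ₗ[K] U // LinearMap.ker f = S} : ℝ) =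
      ∏ i ∈ Finset.range (Module.finrank K (V ⧸ S)),
        ((Fintype.card K : ℝ) ^ Module.finrank K U - (Fintype.card K : ℝ) ^ i) := by
  rw [← natCard_injective_linearMap]
  have e : {f : V →ₗ[K] U // LinearMap.ker f = S} ≃
      {g : V ⧸ S →ₗ[K] U // Function.Injective g} :=
    { toFun f := ⟨S.liftQ f.1 f.2.ge, LinearMap.ker_eq_bot.1 (S.ker_liftQ_eq_bot _ _ f.2.le)⟩
      invFun g := ⟨g.1 ∘ₗ S.mkQ, by
        rw [LinearMap.ker_comp, LinearMap.ker_eq_bot.2 g.2, Submodule.comap_bot, S.ker_mkQ]⟩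
      left_inv f := by ext; simp
      right_inv g := by ext; simp }
  rw [Nat.card_congr e]

/-- **Cauchy binomial theorem**, indexed by the submodules above `T`. -/
theorem Submodule.sum_prod_X_sub_C {K V : Type*} [Field K] [Fintype K]
    [AddCommGroup V] [Module K V] [Finite V] [Fintype (Submodule K V)] (T : Submodule K V) :
    ∑ S : Submodule K V with T ≤ S,
        ∏ i ∈ Finset.range (Module.finrank K (V ⧸ S)), (X - C ((Fintype.card K : ℝ) ^ i)) =
      (X : ℝ[X]) ^ Module.finrank K (V ⧸ T) := by
  have hq : 1 < (Fintype.card K : ℝ) := by exact_mod_cast Fintype.one_lt_card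
  refine Polynomial.eq_of_infinite_eval_eq _ _ (Set.Infinite.mono ?_
    (Set.infinite_range_of_injective (pow_right_injective₀ (by linarith) hq.ne')))
  rintro _ ⟨m, rfl⟩
  simp only [Set.mem_ofPred_eq, eval_finsetSum, eval_prod, eval_sub, eval_X, eval_C, eval_pow]
  have hm : Module.finrank K (Fin m → K) = m := by simp
  have hfin : Finite (V →ₗ[K] Fin m → K) := Finite.of_injective _ DFunLike.coe_injective
  have e : {f : V →ₗ[K] Fin m → K // T ≤ LinearMap.ker f} ≃
      Σ S : {S : Submodule K V // T ≤ S}, {f : V →ₗ[K] Fin m → K // LinearMap.ker f = S} :=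
    { toFun f := ⟨⟨LinearMap.ker f.1, f.2⟩, f.1, rfl⟩
      invFun p := ⟨p.2.1, p.1.2.trans p.2.2.ge⟩
      left_inv f := rfl
      right_inv := by
        rintro ⟨⟨S, hS⟩, f, hf : LinearMap.ker f = S⟩
        subst hf
        rfl }
  have h := (Nat.card_congr e).symm.trans (Nat.card_congr T.liftQEquiv)
  rw [Nat.card_sigma, Module.natCard_eq_pow_finrank (K := K), Module.finrank_linearMap, hm,
    Nat.card_eq_fintype_card] at h
  have h' := congrArg (Nat.cast : ℕ → ℝ) h
  push_cast at h'
  simp only [Submodule.natCard_ker_eq, hm] at h'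
  rw [← pow_mul, mul_comm m, ← h']
  exact (Finset.sum_subtype _ (by simp) fun S : Submodule K V =>
    ∏ i ∈ Finset.range (Module.finrank K (V ⧸ S)),
      ((Fintype.card K : ℝ) ^ m - (Fintype.card K : ℝ) ^ i))

/-- The derivative at `1` of the Cauchy binomial theorem. -/
theorem Submodule.sum_prod_one_sub {K V : Type*} [Field K] [Fintype K]
    [AddCommGroup V] [Module K V] [Finite V] [Fintype (Submodule K V)] (T : Submodule K V) :
    ∑ S : Submodule K V with T ≤ S ∧ S ≠ ⊤,
        ∏ i ∈ Finset.Icc 1 (Module.finrank K (V ⧸ S) - 1), (1 - (Fintype.card K : ℝ) ^ i) =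
      Module.finrank K (V ⧸ T) := by
  have hsplit (S : Submodule K V) (hS : S ≠ ⊤) :
      ∏ i ∈ Finset.range (Module.finrank K (V ⧸ S)), (X - C ((Fintype.card K : ℝ) ^ i)) =
        (X - C 1) * ∏ i ∈ Finset.Icc 1 (Module.finrank K (V ⧸ S) - 1),
          (X - C ((Fintype.card K : ℝ) ^ i)) := by
    have : Nontrivial (V ⧸ S) := Submodule.Quotient.nontrivial_iff.2 hS
    obtain ⟨d, hd⟩ := Nat.exists_eq_succ_of_ne_zero
      (Module.finrank_pos (R := K) (M := V ⧸ S)).ne'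
    rw [hd, Finset.prod_range_succ', pow_zero, mul_comm, Nat.succ_sub_one,
      Finset.range_eq_Ico, Finset.prod_Ico_add' (fun i => X - C ((Fintype.card K : ℝ) ^ i))]
    rfl
  have h := T.sum_prod_X_sub_C
  rw [← Finset.sum_filter_add_sum_filter_not _ (· ≠ ⊤), Finset.filter_filter,
    Finset.sum_congr rfl fun S hS => hsplit S (Finset.mem_filter.1 hS).2.2, ← Finset.mul_sum] at h
  have htop : (Finset.univ.filter (T ≤ ·)).filter (fun S : Submodule K V => ¬ S ≠ ⊤) = {⊤} := by
    ext S
    simp +contextual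
  have h0 : Module.finrank K (V ⧸ (⊤ : Submodule K V)) = 0 := Module.finrank_zero_of_subsingleton
  rw [htop, Finset.sum_singleton, h0, Finset.prod_range_zero, ← eq_sub_iff_add_eq,
    ← mul_geom_sum, ← C_1] at h
  simpa [eval_finsetSum, eval_prod] using
    congrArg (eval 1) (mul_left_cancel₀ (X_sub_C_ne_zero (1 : ℝ)) h)

end

/-- The probability that all revealed indices lie in `A`. -/
theorem sum_subset_pow_mul_pow {n : ℕ} (ε : ℝ) (A : Finset (Fin n)) :
    ∑ r : Finset (Fin n) with r ⊆ A, ε ^ (n - r.card) * (1 - ε) ^ r.card = ε ^ (n - A.card) := by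
  have hA : A.card ≤ n := by simpa using A.card_le_univ
  have hfilter : Finset.univ.filter (· ⊆ A) = A.powerset := by ext; simp
  rw [hfilter]
  calc _ = ∑ r ∈ A.powerset,
          ε ^ (n - A.card) * ((1 - ε) ^ r.card * ε ^ (A.card - r.card)) := by
        refine Finset.sum_congr rfl fun r hr => ?_
        have hr' := Finset.card_le_card (Finset.mem_powerset.1 hr)
        rw [show n - r.card = (n - A.card) + (A.card - r.card) by omega, pow_add]
        ring
    _ = ε ^ (n - A.card) := by
        rw [← Finset.mul_sum, Finset.sum_pow_mul_eq_add_pow, sub_add_cancel, one_pow, mul_one]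

/-- Möbius-type expansion of the rank as a sum over the proper subspaces containing the columns
indexed by `r`. -/
theorem colRank_eq_sub {κ n : ℕ} (G : Matrix (Fin κ) (Fin n) (ZMod 2)) (r : Finset (Fin n)) :
    (colRank G r : ℝ) = κ - ∑ S : Submodule (ZMod 2) (Fin κ → ZMod 2) with
      r ⊆ Finset.univ.filter (fun j : Fin n => (fun i => G i j) ∈ S) ∧ S ≠ ⊤,
        ∏ i ∈ Finset.Icc 1 (κ - Module.finrank (ZMod 2) S - 1), (1 - (2 : ℝ) ^ i) := by
  have hcodim (S : Submodule (ZMod 2) (Fin κ → ZMod 2)) :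
      Module.finrank (ZMod 2) ((Fin κ → ZMod 2) ⧸ S) + Module.finrank (ZMod 2) S = κ := by
    simpa using S.finrank_quotient_add_finrank
  have h := (Submodule.span (ZMod 2)
    ((fun j => fun i => G i j) '' (r : Set (Fin n)))).sum_prod_one_sub
  have hκ := congrArg (Nat.cast : ℕ → ℝ) (hcodim (Submodule.span (ZMod 2)
    ((fun j => fun i => G i j) '' (r : Set (Fin n)))))
  rw [Nat.cast_add, ← h] at hκ
  rw [eq_sub_iff_add_eq', ← hκ, colRank]
  congr 1
  refine Finset.sum_congr ?_ fun S _ => ?_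
  · ext S
    simp [Submodule.span_le, Finset.subset_iff, Set.subset_def]
  · rw [← Nat.eq_sub_of_add_eq (hcodim S), ZMod.card]
    norm_cast

/-- Theorem 1 (fixed erasure probability `ε`): the expected rank of the revealed-column
submatrix equals `κ − Σ_{δ=1}^{κ} K_δ Σ_{dim S = κ−δ} ε^{n−m_S}`. -/
theorem equivocation_eps (κ n : ℕ) (hκ : 1 ≤ κ) (hn : 1 ≤ n)
    (G : Matrix (Fin κ) (Fin n) (ZMod 2)) (ε : ℝ) (hε0 : 0 < ε) (hε1 : ε < 1) :
    ∑ r : Finset (Fin n), ε ^ (n - r.card) * (1 - ε) ^ r.card * (colRank G r : ℝ)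
      = (κ : ℝ) -
          ∑ δ ∈ Finset.Icc 1 κ,
            (∏ i ∈ Finset.Icc 1 (δ - 1), (1 - (2 : ℝ) ^ i)) *
              ∑ S ∈ Finset.univ.filter
                  (fun S : Submodule (ZMod 2) (Fin κ → ZMod 2) =>
                    Module.finrank (ZMod 2) S = κ - δ),
                ε ^ (n - colCount G S) := by
  have hle (S : Submodule (ZMod 2) (Fin κ → ZMod 2)) : Module.finrank (ZMod 2) S ≤ κ := by
    simpa using S.finrank_le
  have htotal : ∑ r : Finset (Fin n), ε ^ (n - r.card) * (1 - ε) ^ r.card = 1 := by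
    simpa using sum_subset_pow_mul_pow ε (Finset.univ : Finset (Fin n))
  have hRHS : ∑ δ ∈ Finset.Icc 1 κ, (∏ i ∈ Finset.Icc 1 (δ - 1), (1 - (2 : ℝ) ^ i)) *
        ∑ S ∈ Finset.univ.filter (fun S : Submodule (ZMod 2) (Fin κ → ZMod 2) =>
          Module.finrank (ZMod 2) S = κ - δ), ε ^ (n - colCount G S) =
      ∑ S : Submodule (ZMod 2) (Fin κ → ZMod 2) with S ≠ ⊤,
        (∏ i ∈ Finset.Icc 1 (κ - Module.finrank (ZMod 2) S - 1), (1 - (2 : ℝ) ^ i)) *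
          ε ^ (n - colCount G S) := by
    have hmaps : ∀ S ∈ Finset.univ.filter
        (fun S : Submodule (ZMod 2) (Fin κ → ZMod 2) => S ≠ ⊤),
        κ - Module.finrank (ZMod 2) S ∈ Finset.Icc 1 κ := by
      intro S hS
      have : Module.finrank (ZMod 2) S < κ := by
        simpa using Submodule.finrank_lt (Finset.mem_filter.1 hS).2
      simp only [Finset.mem_Icc]
      omega
    rw [← Finset.sum_fiberwise_of_maps_to hmaps]
    refine Finset.sum_congr rfl fun δ hδ => ?_
    rw [Finset.mem_Icc] at hδ
    rw [Finset.mul_sum]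
    refine Finset.sum_congr ?_ fun S hS => ?_
    · ext S
      have := hle S
      have htop : S = ⊤ → Module.finrank (ZMod 2) S = κ := by
        rintro rfl
        simp
      simp only [Finset.mem_filter, Finset.mem_univ, true_and]
      constructor
      · intro h
        exact ⟨fun hS => by have := htop hS; omega, by omega⟩
      · rintro ⟨-, h⟩
        omega
    · rw [Finset.mem_filter] at hS
      rw [hS.2]
  rw [hRHS]
  simp only [colRank_eq_sub, mul_sub, Finset.sum_sub_distrib, ← Finset.sum_mul, htotal, one_mul]
  congr 1
  simp only [Finset.mul_sum, Finset.sum_filter]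
  rw [Finset.sum_comm]
  refine Finset.sum_congr rfl fun S _ => ?_
  split_ifs with hS
  · rw [colCount, ← sum_subset_pow_mul_pow, Finset.mul_sum, Finset.sum_filter]
    refine Finset.sum_congr rfl fun r _ => ?_
    simp only [hS, and_true, mul_ite, zero_mul, mul_comm, ne_eq, not_false_eq_true]
  · simp [hS]
end

section
/- Fixed-erasure-count χ² formula (Theorem 5, μ version): for every integer μ with 1 ≤ μ ≤ n, Σ_{r ⊆ Fin n, |r| = μ} 2^{κ − rank(G_r)} = C(n,μ) + Σ_{S : dim S = κ−1} C(m_S, μ), where C(·,·) is the ordinary binomial coefficient and the right-hand sum is over all (κ−1)-dimensional subspaces S of (ZMod 2)^κ; the identity holds in the integers (note rank(G_r) ≤ κ). -/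
attribute [local instance] Classical.propDecidable

/-- A subspace `W` of `𝔽₂^κ` is contained in exactly `2^(κ - dim W) - 1` hyperplanes. -/
theorem two_pow_codim_eq_one_add_card_hyperplanes {κ : ℕ} (hκ : 1 ≤ κ)
    (W : Submodule (ZMod 2) (Fin κ → ZMod 2)) :
    2 ^ (κ - Module.finrank (ZMod 2) W) =
      1 + (Finset.univ.filter (fun S : Submodule (ZMod 2) (Fin κ → ZMod 2) =>
        Module.finrank (ZMod 2) S = κ - 1 ∧ W ≤ S)).card := by
  have : Finite (Module.Dual (ZMod 2) (Fin κ → ZMod 2)) := Module.finite_of_finite (ZMod 2)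
  have hdim (U : Submodule (ZMod 2) (Fin κ → ZMod 2)) :
      Module.finrank (ZMod 2) U + Module.finrank (ZMod 2) U.dualAnnihilator = κ := by
    simpa using Subspace.finrank_add_finrank_dualAnnihilator_eq U
  have hker {f : Module.Dual (ZMod 2) (Fin κ → ZMod 2)} (hf : f ≠ 0) :
      Module.finrank (ZMod 2) (LinearMap.ker f) = κ - 1 := by
    have := Module.Dual.finrank_ker_add_one_of_ne_zero hf
    simp only [Module.finrank_fintype_fun_eq_card, Fintype.card_fin] at this
    omega
  have hcard : Nat.card W.dualAnnihilator = 2 ^ (κ - Module.finrank (ZMod 2) W) := by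
    rw [Module.natCard_eq_pow_finrank (K := ZMod 2), Nat.card_zmod]
    congr 1
    have := hdim W
    omega
  have himage : LinearMap.ker ''
      ((W.dualAnnihilator : Set (Module.Dual (ZMod 2) (Fin κ → ZMod 2))) \ {0}) =
      {S : Submodule (ZMod 2) (Fin κ → ZMod 2) |
        Module.finrank (ZMod 2) S = κ - 1 ∧ W ≤ S} := by
    ext S
    constructor
    · rintro ⟨f, ⟨hfW, hf⟩, rfl⟩
      exact ⟨hker hf, fun w hw => (Submodule.mem_dualAnnihilator f).1 hfW w hw⟩
    · rintro ⟨hS, hWS⟩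
      have hne : S.dualAnnihilator ≠ ⊥ := by
        intro h
        have := hdim S
        rw [h, finrank_bot] at this
        omega
      obtain ⟨f, hfS, hf⟩ := Submodule.exists_mem_ne_zero_of_ne_bot hne
      refine ⟨f, ⟨Submodule.dualAnnihilator_anti hWS hfS, hf⟩, ?_⟩
      refine (Submodule.eq_of_le_of_finrank_eq
        (fun w hw => (Submodule.mem_dualAnnihilator f).1 hfS w hw) ?_).symm
      rw [hS, hker hf]
  have hinj : Function.Injective
      (LinearMap.ker : Module.Dual (ZMod 2) (Fin κ → ZMod 2) → Submodule _ _) := by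
    intro f g hfg
    ext1 i
    have h := SetLike.ext_iff.1 hfg (Pi.single i 1)
    have hZ : ∀ a b : ZMod 2, (a = 0 ↔ b = 0) → a = b := by decide
    ext
    exact hZ _ _ h
  rw [← hcard, ← Set.ncard_coe_finset, Finset.coe_filter_univ, ← himage,
    Set.ncard_image_of_injective _ hinj, add_comm,
    Set.ncard_sdiff_singleton_add_one W.dualAnnihilator.zero_mem]
  rfl

/-- Theorem 5 (fixed number of revealed bits `μ`):
`Σ_{|r|=μ} 2^{κ−rank(G_r)} = C(n,μ) + Σ_{dim S = κ−1} C(m_S, μ)`. -/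
theorem chiSq_mu (κ n : ℕ) (hκ : 1 ≤ κ) (hn : 1 ≤ n)
    (G : Matrix (Fin κ) (Fin n) (ZMod 2)) (μ : ℕ) (hμ1 : 1 ≤ μ) (hμn : μ ≤ n) :
    ∑ r ∈ Finset.powersetCard μ (Finset.univ : Finset (Fin n)),
        (2 : ℤ) ^ (κ - colRank G r)
      = (n.choose μ : ℤ) +
          ∑ S ∈ Finset.univ.filter
              (fun S : Submodule (ZMod 2) (Fin κ → ZMod 2) =>
                Module.finrank (ZMod 2) S = κ - 1),
            ((colCount G S).choose μ : ℤ) := by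
  have hpow (r : Finset (Fin n)) : (2 : ℤ) ^ (κ - colRank G r) =
      1 + ∑ S ∈ Finset.univ.filter (fun S : Submodule (ZMod 2) (Fin κ → ZMod 2) =>
        Module.finrank (ZMod 2) S = κ - 1), if ∀ j ∈ r, (fun i => G i j) ∈ S then 1 else 0 := by
    rw [Finset.sum_boole, Finset.filter_filter]
    have h := two_pow_codim_eq_one_add_card_hyperplanes hκ
      (Submodule.span (ZMod 2) ((fun j => fun i => G i j) '' (r : Set (Fin n))))
    simp only [Submodule.span_le, ← colRank.eq_1, Set.subset_def,
      Set.forall_mem_image, SetLike.mem_coe] at h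
    exact_mod_cast h
  simp only [hpow]
  rw [Finset.sum_add_distrib, Finset.sum_comm]
  congr 1
  · simp
  · refine Finset.sum_congr rfl fun S _ => ?_
    rw [Finset.sum_boole, colCount, ← Finset.card_powersetCard]
    congr 2
    ext r
    simp only [Finset.mem_filter, Finset.mem_powersetCard, Finset.subset_iff, Finset.mem_univ,
      true_and]
    tauto
end

section
/- Fixed-erasure-probability χ² formula (Theorem 5, ε version): for every real ε with 0 < ε < 1, 2^κ · Σ_{r ⊆ Fin n} ε^{n−|r|} (1−ε)^{|r|} · 2^{|r| − rank(G_r)} = (2−ε)^n + Σ_{S : dim S = κ−1} ε^{n − m_S} (2−ε)^{m_S}, where the left sum is over all subsets r of Fin n and the right sum is over all (κ−1)-dimensional subspaces S of (ZMod 2)^κ. -/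
attribute [local instance] Classical.propDecidable

open Module

theorem Module.Dual.eq_of_ker_eq_zmod_two {V : Type*} [AddCommGroup V] [Module (ZMod 2) V]
    {f g : Dual (ZMod 2) V} (h : LinearMap.ker f = LinearMap.ker g) : f = g := by
  have two : ∀ a b : ZMod 2, (a = 0 ↔ b = 0) → a = b := by decide
  ext x
  exact two _ _ (by rw [← LinearMap.mem_ker, h, LinearMap.mem_ker])

/-- Over `ZMod 2`, taking kernels identifies nonzero functionals with hyperplanes. -/
theorem sum_ker_dual_ne_zero {κ : ℕ} (hκ : 1 ≤ κ) [Fintype (Dual (ZMod 2) (Fin κ → ZMod 2))]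
    (F : Submodule (ZMod 2) (Fin κ → ZMod 2) → ℝ) :
    ∑ f ∈ Finset.univ.erase (0 : Dual (ZMod 2) (Fin κ → ZMod 2)), F (LinearMap.ker f) =
      ∑ S ∈ Finset.univ.filter
        (fun S : Submodule (ZMod 2) (Fin κ → ZMod 2) => finrank (ZMod 2) S = κ - 1), F S := by
  have hker : ∀ f : Dual (ZMod 2) (Fin κ → ZMod 2), f ≠ 0 →
      finrank (ZMod 2) (LinearMap.ker f) = κ - 1 := fun f hf => by
    have := Module.Dual.finrank_ker_add_one_of_ne_zero hf
    rw [finrank_fin_fun] at this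
    omega
  refine Finset.sum_nbij LinearMap.ker ?_ ?_ ?_ fun _ _ => rfl
  · intro f hf
    simpa using hker f (Finset.ne_of_mem_erase hf)
  · intro f _ g _ h
    exact Module.Dual.eq_of_ker_eq_zmod_two h
  · intro S hS
    have hS : finrank (ZMod 2) S = κ - 1 := by simpa using hS
    have hlt : S < ⊤ := by
      rw [lt_top_iff_ne_top]
      rintro rfl
      rw [finrank_top, finrank_fin_fun] at hS
      omega
    obtain ⟨f, hf, hle⟩ := Submodule.exists_le_ker_of_lt_top S hlt
    exact ⟨f, by simpa using hf,
      (Submodule.eq_of_le_of_finrank_eq hle (hS.trans (hker f hf).symm)).symm⟩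

theorem colRank_le_card {κ n : ℕ} (G : Matrix (Fin κ) (Fin n) (ZMod 2)) (r : Finset (Fin n)) :
    colRank G r ≤ r.card := by
  unfold colRank
  rw [← Finset.coe_image]
  exact (finrank_span_finset_le_card _).trans Finset.card_image_le

/-- The functionals vanishing on the columns in `r` number `2 ^ (κ - rank G_r)`. -/
theorem two_pow_mul_two_pow_sub_colRank {κ n : ℕ} (G : Matrix (Fin κ) (Fin n) (ZMod 2))
    [Fintype (Dual (ZMod 2) (Fin κ → ZMod 2))] (r : Finset (Fin n)) :
    (2 : ℝ) ^ κ * 2 ^ (r.card - colRank G r) =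
      ∑ f : Dual (ZMod 2) (Fin κ → ZMod 2),
        ∏ j ∈ r, if (fun i => G i j) ∈ LinearMap.ker f then (2 : ℝ) else 0 := by
  set W := Submodule.span (ZMod 2) ((fun j => fun i => G i j) '' (r : Set (Fin n))) with hW
  have hfin : colRank G r + finrank (ZMod 2) W.dualAnnihilator = κ := by
    simpa [colRank, hW] using Subspace.finrank_add_finrank_dualAnnihilator_eq W
  have hcard : (Finset.univ.filter fun f : Dual (ZMod 2) (Fin κ → ZMod 2) =>
      ∀ j ∈ r, (fun i => G i j) ∈ LinearMap.ker f).card =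
        2 ^ finrank (ZMod 2) W.dualAnnihilator := by
    have h := Module.natCard_eq_pow_finrank (K := ZMod 2) (V := W.dualAnnihilator)
    rw [Nat.card_zmod] at h
    rw [← h, Nat.card_eq_fintype_card, Fintype.card_subtype]
    congr 1
    ext f
    simp only [Finset.mem_filter, Finset.mem_univ, true_and]
    rw [← SetLike.mem_coe, hW, Submodule.coe_dualAnnihilator_span]
    simp [Set.subset_def]
  have hprod : ∀ f : Dual (ZMod 2) (Fin κ → ZMod 2),
      (∏ j ∈ r, if (fun i => G i j) ∈ LinearMap.ker f then (2 : ℝ) else 0) =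
        if ∀ j ∈ r, (fun i => G i j) ∈ LinearMap.ker f then 2 ^ r.card else 0 := fun f => by
    rw [Finset.prod_ite_zero, Finset.prod_const]
    congr
  have hle := colRank_le_card G r
  simp_rw [hprod]
  rw [← Finset.sum_filter, Finset.sum_const, hcard, nsmul_eq_mul]
  push_cast
  rw [← pow_add, ← pow_add]
  congr 1
  omega

theorem sum_pow_mul_prod_ite {κ n : ℕ} (G : Matrix (Fin κ) (Fin n) (ZMod 2))
    (S : Submodule (ZMod 2) (Fin κ → ZMod 2)) (ε : ℝ) :
    ∑ r : Finset (Fin n), ε ^ (n - r.card) * (1 - ε) ^ r.card *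
        ∏ j ∈ r, (if (fun i => G i j) ∈ S then (2 : ℝ) else 0) =
      ε ^ (n - colCount G S) * (2 - ε) ^ colCount G S := by
  trans ∏ j : Fin n, ((1 - ε) * (if (fun i => G i j) ∈ S then (2 : ℝ) else 0) + ε)
  · rw [Finset.prod_add, Finset.powerset_univ]
    refine Finset.sum_congr rfl fun r _ => ?_
    rw [Finset.prod_mul_distrib, Finset.prod_const, Finset.prod_const,
      Finset.card_sdiff_of_subset (Finset.subset_univ r), Finset.card_univ, Fintype.card_fin]
    ring
  · have hfactor : ∀ j : Fin n, (1 - ε) * (if (fun i => G i j) ∈ S then (2 : ℝ) else 0) + ε =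
        if (fun i => G i j) ∈ S then 2 - ε else ε := fun j => by
      split_ifs <;> ring
    have hcard := Finset.card_filter_add_card_filter_not (s := (Finset.univ : Finset (Fin n)))
      (fun j => (fun i => G i j) ∈ S)
    rw [Finset.card_univ, Fintype.card_fin] at hcard
    simp_rw [hfactor]
    rw [Finset.prod_ite, Finset.prod_const, Finset.prod_const, mul_comm, colCount]
    congr 2
    omega

/-- Theorem 5 (fixed erasure probability `ε`):
`2^κ · Σ_r ε^{n−|r|}(1−ε)^{|r|} 2^{|r|−rank(G_r)} = (2−ε)^n + Σ_{dim S = κ−1} ε^{n−m_S}(2−ε)^{m_S}`. -/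
theorem chiSq_eps (κ n : ℕ) (hκ : 1 ≤ κ) (hn : 1 ≤ n)
    (G : Matrix (Fin κ) (Fin n) (ZMod 2)) (ε : ℝ) (hε0 : 0 < ε) (hε1 : ε < 1) :
    (2 : ℝ) ^ κ *
        ∑ r : Finset (Fin n),
          ε ^ (n - r.card) * (1 - ε) ^ r.card * (2 : ℝ) ^ (r.card - colRank G r)
      = (2 - ε) ^ n +
          ∑ S ∈ Finset.univ.filter
              (fun S : Submodule (ZMod 2) (Fin κ → ZMod 2) =>
                Module.finrank (ZMod 2) S = κ - 1),
            ε ^ (n - colCount G S) * (2 - ε) ^ colCount G S := by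
  have : Finite (Dual (ZMod 2) (Fin κ → ZMod 2)) := Module.finite_of_finite (ZMod 2)
  let _ : Fintype (Dual (ZMod 2) (Fin κ → ZMod 2)) := Fintype.ofFinite _
  have hzero : colCount G (LinearMap.ker (0 : Dual (ZMod 2) (Fin κ → ZMod 2))) = n := by
    simp [colCount]
  rw [← sum_ker_dual_ne_zero hκ fun S => ε ^ (n - colCount G S) * (2 - ε) ^ colCount G S]
  calc
    _ = ∑ r : Finset (Fin n), ∑ f : Dual (ZMod 2) (Fin κ → ZMod 2),
          ε ^ (n - r.card) * (1 - ε) ^ r.card *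
            ∏ j ∈ r, (if (fun i => G i j) ∈ LinearMap.ker f then (2 : ℝ) else 0) := by
      rw [Finset.mul_sum]
      refine Finset.sum_congr rfl fun r _ => ?_
      rw [← Finset.mul_sum, ← two_pow_mul_two_pow_sub_colRank]
      ring
    _ = ∑ f : Dual (ZMod 2) (Fin κ → ZMod 2),
          ε ^ (n - colCount G (LinearMap.ker f)) * (2 - ε) ^ colCount G (LinearMap.ker f) := by
      rw [Finset.sum_comm]
      exact Finset.sum_congr rfl fun f _ => sum_pow_mul_prod_ite G _ ε
    _ = _ := by
      rw [← Finset.add_sum_erase _ _ (Finset.mem_univ 0), hzero, Nat.sub_self, pow_zero, one_mul]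
end
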